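/- Let μ ∈ V^m(𝒲) have support {x_1,…,x_n}, let 𝒰 = {U_1,…,U_n} be pairwise disjoint open subsets of X with x_i ∈ U_i for all i and with U_1 ∪ ⋯ ∪ U_n contained in some member of 𝒲, and let ε > 0. Then there exists a continuous map f : P_𝒰 → V^m(𝒲) such that f(ζ) ∈ P(μ,𝒰,ε) and supp(f(ζ)) ⊆ supp(ζ) for every ζ ∈ P_𝒰, and moreover f(μ) = μ. -/

import Mathlib

open MeasureTheory Set

/-- The support of a probability measure: the set of points all of whose open
neighborhoods have positive measure. -/
def msupp {X : Type*} [TopologicalSpace X] [MeasurableSpace X]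
    (μ : ProbabilityMeasure X) : Set X :=
  {x | ∀ U : Set X, IsOpen U → x ∈ U → μ.toMeasure U ≠ 0}

/-- The Vietoris metric thickening of a cover `𝒲`. -/
def VietorisThickening {X : Type*} [TopologicalSpace X] [MeasurableSpace X]
    (𝒲 : Set (Set X)) : Set (ProbabilityMeasure X) :=
  {μ | (msupp μ).Finite ∧ ∃ W ∈ 𝒲, msupp μ ⊆ W}

/-- The set `P(μ,𝒰,ε)`. -/
def Pnbhd {X : Type*} [TopologicalSpace X] [MeasurableSpace X]
    (𝒲 : Set (Set X)) (μ : ProbabilityMeasure X) {n : ℕ} (U : Fin n → Set X) (ε : ℝ) :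
    Set (ProbabilityMeasure X) :=
  {ν | ν ∈ VietorisThickening 𝒲 ∧ msupp ν ⊆ ⋃ i, U i ∧
    ∀ i, |(ν (U i) : ℝ) - (μ (U i) : ℝ)| ≤ ε}

/-- The set `P_𝒰` of measures in the thickening whose support meets every `U i`. -/
def PmeetsAll {X : Type*} [TopologicalSpace X] [MeasurableSpace X]
    (𝒲 : Set (Set X)) {n : ℕ} (U : Fin n → Set X) : Set (ProbabilityMeasure X) :=
  {ζ | ζ ∈ VietorisThickening 𝒲 ∧ ∀ i, (msupp ζ ∩ U i).Nonempty}

section Support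

variable {X : Type*} [TopologicalSpace X] [MeasurableSpace X]

theorem msupp_eq_support (μ : ProbabilityMeasure X) :
    msupp μ = (μ : Measure X).support := by
  rw [Measure.support_eq_forall_isOpen]
  ext x
  simp only [msupp, mem_ofPred_eq, pos_iff_ne_zero]
  exact forall_congr' fun _ => forall_comm

theorem measure_compl_msupp [HereditarilyLindelofSpace X] (μ : ProbabilityMeasure X) :
    (μ : Measure X) (msupp μ)ᶜ = 0 := by
  rw [msupp_eq_support, Measure.measure_compl_support]

theorem ae_mem_msupp [HereditarilyLindelofSpace X] (μ : ProbabilityMeasure X) :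
    ∀ᵐ x ∂(μ : Measure X), x ∈ msupp μ :=
  measure_compl_msupp μ

theorem msupp_mono {μ ν : ProbabilityMeasure X} (h : (μ : Measure X) ≪ ν) :
    msupp μ ⊆ msupp ν := by
  simpa only [msupp_eq_support] using h.support_mono

theorem measure_singleton_ne_zero_of_mem_msupp [T1Space X] [HereditarilyLindelofSpace X]
    {μ : ProbabilityMeasure X} (hfin : (msupp μ).Finite) {x : X} (hx : x ∈ msupp μ) :
    (μ : Measure X) {x} ≠ 0 := by
  intro h
  refine hx (msupp μ \ {x})ᶜ (hfin.subset sdiff_subset).isClosed.isOpen_compl (by simp) ?_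
  have hsub : (msupp μ \ {x})ᶜ ⊆ (msupp μ)ᶜ ∪ {x} := by
    intro y
    simp only [mem_compl_iff, mem_sdiff, mem_union, mem_singleton_iff]
    tauto
  exact measure_mono_null hsub (measure_union_null (measure_compl_msupp μ) h)

end Support

theorem ContinuousMap.integrable_of_compactSpace {X : Type*} [TopologicalSpace X] [CompactSpace X]
    [MeasurableSpace X] [OpensMeasurableSpace X] (φ : C(X, ℝ)) (μ : Measure X)
    [IsFiniteMeasure μ] : Integrable φ μ :=
  (BoundedContinuousFunction.mkOfCompact φ).integrable μ

section Reweight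

variable {X : Type*} [TopologicalSpace X] [MeasurableSpace X] {ι : Type*} [Fintype ι]

/-- The density that rescales each bump function `φ i` to have total mass `c i`. -/
noncomputable def bumpDensity (c : ι → ℝ) (φ : ι → C(X, ℝ)) (ζ : Measure X) : C(X, ℝ) :=
  ∑ i, (c i / ∫ y, φ i y ∂ζ) • φ i

theorem bumpDensity_apply (c : ι → ℝ) (φ : ι → C(X, ℝ)) (ζ : Measure X) (x : X) :
    bumpDensity c φ ζ x = ∑ i, c i / (∫ y, φ i y ∂ζ) * φ i x := by
  simp [bumpDensity]

theorem bumpDensity_nonneg {c : ι → ℝ} {φ : ι → C(X, ℝ)} (hc : ∀ i, 0 ≤ c i)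
    (hφ : ∀ i x, 0 ≤ φ i x) (ζ : Measure X) (x : X) : 0 ≤ bumpDensity c φ ζ x := by
  rw [bumpDensity_apply]
  exact Finset.sum_nonneg fun i _ =>
    mul_nonneg (div_nonneg (hc i) (integral_nonneg (hφ i))) (hφ i x)

theorem bumpDensity_eq_of_mem {c : ι → ℝ} {φ : ι → C(X, ℝ)} {U : ι → Set X}
    (hU : Pairwise (Function.onFun Disjoint U)) (hφU : ∀ i, ∀ x ∉ U i, φ i x = 0)
    (ζ : Measure X) {i : ι} {x : X} (hx : x ∈ U i) :
    bumpDensity c φ ζ x = c i / (∫ y, φ i y ∂ζ) * φ i x := by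
  rw [bumpDensity_apply]
  refine Finset.sum_eq_single i (fun j _ hj => ?_) (by simp)
  rw [hφU j x (disjoint_right.mp (hU hj) hx), mul_zero]

theorem setIntegral_bumpDensity {c : ι → ℝ} {φ : ι → C(X, ℝ)} {U : ι → Set X}
    (hUm : ∀ i, MeasurableSet (U i))
    (hU : Pairwise (Function.onFun Disjoint U)) (hφU : ∀ i, ∀ x ∉ U i, φ i x = 0)
    (ζ : Measure X) (i : ι) (hpos : ∫ y, φ i y ∂ζ ≠ 0) :
    ∫ x in U i, bumpDensity c φ ζ x ∂ζ = c i := by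
  rw [setIntegral_congr_fun (hUm i) fun x hx => bumpDensity_eq_of_mem hU hφU ζ hx,
    integral_const_mul, setIntegral_eq_integral_of_forall_compl_eq_zero (hφU i),
    div_mul_cancel₀ _ hpos]

variable [CompactSpace X] [OpensMeasurableSpace X]

theorem integral_mul_bumpDensity (c : ι → ℝ) (φ : ι → C(X, ℝ)) (ζ : Measure X)
    [IsFiniteMeasure ζ] (g : C(X, ℝ)) :
    ∫ x, bumpDensity c φ ζ x * g x ∂ζ
      = ∑ i, c i / (∫ y, φ i y ∂ζ) * ∫ x, φ i x * g x ∂ζ := by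
  simp_rw [bumpDensity_apply, Finset.sum_mul, mul_assoc]
  rw [integral_finsetSum]
  · simp_rw [integral_const_mul]
  · exact fun i _ => ((φ i * g).integrable_of_compactSpace ζ).const_mul _

theorem integral_bumpDensity (c : ι → ℝ) (φ : ι → C(X, ℝ)) (ζ : Measure X)
    [IsFiniteMeasure ζ] (hpos : ∀ i, ∫ y, φ i y ∂ζ ≠ 0) :
    ∫ x, bumpDensity c φ ζ x ∂ζ = ∑ i, c i := by
  have h := integral_mul_bumpDensity c φ ζ 1
  simp only [ContinuousMap.one_apply, mul_one] at h
  rw [h]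
  exact Finset.sum_congr rfl fun i _ => div_mul_cancel₀ _ (hpos i)

theorem isProbabilityMeasure_withDensity_bumpDensity {c : ι → ℝ} {φ : ι → C(X, ℝ)}
    (hc : ∀ i, 0 ≤ c i) (hc1 : ∑ i, c i = 1) (hφ : ∀ i x, 0 ≤ φ i x) (ζ : Measure X)
    [IsFiniteMeasure ζ] (hpos : ∀ i, ∫ y, φ i y ∂ζ ≠ 0) :
    IsProbabilityMeasure (ζ.withDensity fun x => ENNReal.ofReal (bumpDensity c φ ζ x)) := by
  refine ⟨?_⟩
  rw [withDensity_apply _ MeasurableSet.univ, Measure.restrict_univ,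
    ← ofReal_integral_eq_lintegral_ofReal (ContinuousMap.integrable_of_compactSpace _ ζ)
      (.of_forall (bumpDensity_nonneg hc hφ ζ)), integral_bumpDensity c φ ζ hpos, hc1,
    ENNReal.ofReal_one]

end Reweight

theorem integral_pos_of_msupp_inter_nonempty {X : Type*} [TopologicalSpace X] [CompactSpace X]
    [MeasurableSpace X] [OpensMeasurableSpace X] {ζ : ProbabilityMeasure X} {φ : C(X, ℝ)}
    (hφ : ∀ x, 0 ≤ φ x) {U : Set X} (hUopen : IsOpen U) (hφpos : ∀ x ∈ U, 0 < φ x)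
    (h : (msupp ζ ∩ U).Nonempty) : 0 < ∫ x, φ x ∂(ζ : Measure X) := by
  obtain ⟨x, hx, hxU⟩ := h
  rw [integral_pos_iff_support_of_nonneg hφ (φ.integrable_of_compactSpace _)]
  exact (pos_iff_ne_zero.mpr (hx U hUopen hxU)).trans_le
    (measure_mono fun y hy => (hφpos y hy).ne')

theorem IsOpen.exists_bump {X : Type*} [TopologicalSpace X] [PerfectlyNormalSpace X] {U : Set X}
    (hU : IsOpen U) :
    ∃ φ : C(X, ℝ), (∀ x, 0 ≤ φ x) ∧ (∀ x ∈ U, 0 < φ x) ∧ ∀ x ∉ U, φ x = 0 := by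
  obtain ⟨φ, hφ, hφ01⟩ :=
    perfectlyNormalSpace_iff_forall_isClosed_preimage_zero.mp ‹_› Uᶜ hU.isClosed_compl
  have hzero (x : X) : x ∉ U ↔ φ x = 0 := by
    rw [← mem_compl_iff, hφ]
    rfl
  have hnonneg (x : X) : 0 ≤ φ x := (hφ01 x).1
  exact ⟨φ, hnonneg, fun x hx => (hnonneg x).lt_of_ne' fun h => (hzero x).mpr h hx,
    fun x hx => (hzero x).mp hx⟩

theorem stmt_10 {X : Type*} [MetricSpace X] [CompactSpace X] [MeasurableSpace X] [BorelSpace X]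
    (𝒲 : Set (Set X)) (hWopen : ∀ W ∈ 𝒲, IsOpen W) (hWcover : ⋃₀ 𝒲 = Set.univ)
    (D : ℝ) (hD : 0 < D) (hWbdd : ∀ W ∈ 𝒲, Metric.diam W < D)
    (μ : ProbabilityMeasure X) (hμ : μ ∈ VietorisThickening 𝒲)
    (n : ℕ) (x : Fin n → X) (hxinj : Function.Injective x)
    (hsupp : msupp μ = Set.range x)
    (U : Fin n → Set X) (hUopen : ∀ i, IsOpen (U i))
    (hUdisj : Pairwise (Function.onFun Disjoint U))
    (hxU : ∀ i, x i ∈ U i)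
    (hUW : ∃ W ∈ 𝒲, (⋃ i, U i) ⊆ W)
    (ε : ℝ) (hε : 0 < ε) :
    ∃ f : PmeetsAll 𝒲 U → ProbabilityMeasure X,
      Continuous f ∧
      (∀ ζ : PmeetsAll 𝒲 U, f ζ ∈ Pnbhd 𝒲 μ U ε ∧
        msupp (f ζ) ⊆ msupp (ζ : ProbabilityMeasure X)) ∧
      (∀ hμ' : μ ∈ PmeetsAll 𝒲 U, f ⟨μ, hμ'⟩ = μ) := by
  have hUm (i) : MeasurableSet (U i) := (hUopen i).measurableSet
  choose φ hφ hφpos hφU using fun i => (hUopen i).exists_bump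
  let c : Fin n → ℝ := fun i => (μ (U i) : ℝ)
  have hc (i) : 0 ≤ c i := NNReal.coe_nonneg _
  have hc1 : ∑ i, c i = 1 := by
    have hone : μ.toMeasure (⋃ i, U i) = 1 := by
      rw [← prob_compl_eq_zero_iff (MeasurableSet.iUnion hUm)]
      refine measure_mono_null (compl_subset_compl.mpr ?_) (measure_compl_msupp μ)
      rw [hsupp]
      rintro _ ⟨i, rfl⟩
      exact mem_iUnion_of_mem i (hxU i)
    change ∑ i, (μ.toMeasure).real (U i) = 1
    rw [← measureReal_iUnion_fintype hUdisj hUm, measureReal_def, hone, ENNReal.toReal_one]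
  have hint (ζ : PmeetsAll 𝒲 U) (i) : ∫ y, φ i y ∂(ζ.1 : Measure X) ≠ 0 :=
    (integral_pos_of_msupp_inter_nonempty (hφ i) (hUopen i) (hφpos i) (ζ.2.2 i)).ne'
  let f : PmeetsAll 𝒲 U → ProbabilityMeasure X := fun ζ =>
    ⟨(ζ.1 : Measure X).withDensity fun x => ENNReal.ofReal (bumpDensity c φ ζ.1 x),
      isProbabilityMeasure_withDensity_bumpDensity hc hc1 hφ _ (hint ζ)⟩
  have hf_apply (ζ) {s : Set X} (hs : MeasurableSet s) : (f ζ : Measure X) s =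
      ENNReal.ofReal (∫ x in s, bumpDensity c φ ζ.1 x ∂(ζ.1 : Measure X)) := by
    change Measure.withDensity _ _ s = _
    rw [withDensity_apply _ hs, ← ofReal_integral_eq_lintegral_ofReal
      (ContinuousMap.integrable_of_compactSpace _ _)
      (.of_forall (bumpDensity_nonneg hc hφ _))]
  have hfsupp (ζ) : msupp (f ζ) ⊆ msupp ζ.1 :=
    msupp_mono (withDensity_absolutelyContinuous _ _)
  have hffin (ζ) : (msupp (f ζ)).Finite := ζ.2.1.1.subset (hfsupp ζ)
  refine ⟨f, ?_, fun ζ => ⟨⟨⟨hffin ζ, ?_⟩, ?_, fun i => ?_⟩, hfsupp ζ⟩, fun hμ' => ?_⟩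
  · rw [ProbabilityMeasure.continuous_iff_forall_continuous_integral]
    intro g
    have hg (ζ : PmeetsAll 𝒲 U) : ∫ x, g x ∂(f ζ : Measure X) =
        ∑ i, c i / (∫ y, φ i y ∂(ζ.1 : Measure X)) * ∫ x, φ i x * g x ∂(ζ.1 : Measure X) := by
      refine Eq.trans ?_ (integral_mul_bumpDensity c φ _ g.toContinuousMap)
      change ∫ x, g x ∂(Measure.withDensity _ _) = _
      rw [integral_withDensity_eq_integral_toReal_smul (by fun_prop) (by simp)]
      refine integral_congr_ae (.of_forall fun x => ?_)
      simp [ENNReal.toReal_ofReal (bumpDensity_nonneg hc hφ _ x)]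
    simp_rw [hg]
    have hcont (ψ : C(X, ℝ)) :
        Continuous fun ζ : PmeetsAll 𝒲 U => ∫ x, ψ x ∂(ζ.1 : Measure X) :=
      (ProbabilityMeasure.continuous_integral_boundedContinuousFunction
        (BoundedContinuousFunction.mkOfCompact ψ)).comp continuous_subtype_val
    exact continuous_finsetSum _ fun i _ =>
      (continuous_const.div (hcont (φ i)) fun ζ => hint ζ i).mul
        (hcont (φ i * g.toContinuousMap))
  · obtain ⟨W, hW, hζW⟩ := ζ.2.1.2
    exact ⟨W, hW, (hfsupp ζ).trans hζW⟩
  · intro y hy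
    by_contra hyU
    refine measure_singleton_ne_zero_of_mem_msupp (hffin ζ) hy ?_
    have hzero : bumpDensity c φ ζ.1 y = 0 := by
      rw [bumpDensity_apply]
      exact Finset.sum_eq_zero fun i _ => by
        rw [hφU i y fun h => hyU (mem_iUnion_of_mem i h), mul_zero]
    rw [hf_apply ζ (measurableSet_singleton y), integral_singleton, hzero, smul_zero,
      ENNReal.ofReal_zero]
  · have hfU : (f ζ (U i) : ℝ) = c i := by
      change ((f ζ : Measure X) (U i)).toReal = c i
      rw [hf_apply ζ (hUm i), setIntegral_bumpDensity hUm hUdisj hφU _ i (hint ζ i),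
        ENNReal.toReal_ofReal (hc i)]
    rw [hfU, sub_self, abs_zero]
    exact hε.le
  · apply Subtype.ext
    change Measure.withDensity _ _ = _
    have hae : ∀ᵐ y ∂(μ : Measure X), ∃ i, x i = y := by
      simpa only [hsupp, mem_range] using ae_mem_msupp μ
    have hφint (i) : ∫ y, φ i y ∂(μ : Measure X) = c i * φ i (x i) := by
      rw [← setIntegral_eq_integral_of_forall_compl_eq_zero (hφU i)]
      have hconst : ∀ᵐ y ∂(μ : Measure X), y ∈ U i → φ i y = φ i (x i) := by
        filter_upwards [hae] with y ⟨j, hj⟩ hy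
        obtain rfl : i = j := by
          by_contra hij
          exact disjoint_left.mp (hUdisj hij) hy (hj ▸ hxU j)
        rw [hj]
      rw [setIntegral_congr_ae (hUm i) hconst, setIntegral_const]
      rfl
    have hone : (fun y => ENNReal.ofReal (bumpDensity c φ μ y)) =ᵐ[(μ : Measure X)] 1 := by
      filter_upwards [hae] with y ⟨i, hi⟩
      have hne := hint ⟨μ, hμ'⟩ i
      change ∫ y, φ i y ∂(μ : Measure X) ≠ 0 at hne
      rw [← hi, bumpDensity_eq_of_mem hUdisj hφU _ (hxU i), div_mul_eq_mul_div, ← hφint,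
        div_self hne, ENNReal.ofReal_one, Pi.one_apply]
    rw [withDensity_congr_ae hone, withDensity_one]
    rfl
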